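/- Let {s_a, p_A} be a representation of the labeled space (E,L,𝔅̄) in a C*-algebra B with p_C ≠ 0 for every nonempty C ∈ 𝔅̄, let B be generated as a C*-algebra by {s_a : a ∈ 𝒜} ∪ {p_A : A ∈ 𝔅̄}, and suppose there is a gauge action on B. If B is an AF algebra, then the labeled space (E,L,𝔅̄) has no loops, i.e. there is no A ∈ 𝔅̄ and α ∈ L(AE^{≥1}A) with A ⊆ r(A,α). -/

import Mathlib

/-! # Common framework for labeled graph C*-algebras

Directed graphs, finite paths, labeled spaces `(E, L, 𝔅̄)` where `𝔅̄` is the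
smallest accommodating set closed under relative complements (and containing
the sink parts of its members), loops and generalized loops, representations
of labeled spaces in C*-algebras, gauge actions, infinite projections,
AF algebras, and closed two-sided ideals. -/

noncomputable section

/-- A directed graph with vertex set `V` and edge set `E`. -/
structure DirGraph (V : Type*) (E : Type*) where
  src : E → V
  rng : E → V

variable {V E 𝒜 : Type*}

/-- A (finite) path of positive length in a directed graph: a nonempty list of
composable edges. -/
structure GPath (G : DirGraph V E) where
  edges : List E
  ne : edges ≠ []
  chain : edges.Chain' fun e f => G.rng e = G.src f

namespace GPath

variable {G : DirGraph V E}

/-- The source vertex of a path. -/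
def source (p : GPath G) : V := G.src (p.edges.head p.ne)

/-- The range vertex of a path. -/
def range (p : GPath G) : V := G.rng (p.edges.getLast p.ne)

/-- The length of a path. -/
def length (p : GPath G) : ℕ := p.edges.length

/-- The label word of a path under a labeling `L`. -/
def label (L : E → 𝒜) (p : GPath G) : List 𝒜 := p.edges.map L

end GPath

/-- The set of sinks of a graph (vertices emitting no edge). -/
def DirGraph.sinks (G : DirGraph V E) : Set V := {v | ∀ e, G.src e ≠ v}

/-- `w ∈ L*(E)`: `w` is the label of some path of positive length. -/
def IsLabelWord (G : DirGraph V E) (L : E → 𝒜) (w : List 𝒜) : Prop :=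
  ∃ p : GPath G, p.label L = w

/-- The range `r(w)` of a labeled path `w`. -/
def rngW (G : DirGraph V E) (L : E → 𝒜) (w : List 𝒜) : Set V :=
  {v | ∃ p : GPath G, p.label L = w ∧ p.range = v}

/-- The relative range `r(A, w)` of a labeled path `w` with respect to `A`. -/
def relRng (G : DirGraph V E) (L : E → 𝒜) (A : Set V) (w : List 𝒜) : Set V :=
  {v | ∃ p : GPath G, p.label L = w ∧ p.source ∈ A ∧ p.range = v}

/-- `L(A E^n)`: labels of paths of length exactly `n` with source in `A`. -/
def labelsFromLen (G : DirGraph V E) (L : E → 𝒜) (A : Set V) (n : ℕ) : Set (List 𝒜) :=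
  {w | ∃ p : GPath G, p.source ∈ A ∧ p.length = n ∧ p.label L = w}

/-- `L(A E^{≤n})`: labels of paths of length between `1` and `n` with source in `A`. -/
def labelsFromLe (G : DirGraph V E) (L : E → 𝒜) (A : Set V) (n : ℕ) : Set (List 𝒜) :=
  {w | ∃ p : GPath G, p.source ∈ A ∧ p.length ≤ n ∧ p.label L = w}

/-- `L(A E^{≥n})`: labels of paths of length at least `n` (and at least `1`)
with source in `A`. -/
def labelsFromGe (G : DirGraph V E) (L : E → 𝒜) (A : Set V) (n : ℕ) : Set (List 𝒜) :=
  {w | ∃ p : GPath G, p.source ∈ A ∧ n ≤ p.length ∧ p.label L = w}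

/-- `L(E^n A)`: labels of paths of length exactly `n` with range in `A`. -/
def labelsToLen (G : DirGraph V E) (L : E → 𝒜) (n : ℕ) (A : Set V) : Set (List 𝒜) :=
  {w | ∃ p : GPath G, p.range ∈ A ∧ p.length = n ∧ p.label L = w}

/-- `L(E^{≤l} v)`: labels of paths of length between `1` and `l` with range `v`. -/
def labelsToLe (G : DirGraph V E) (L : E → 𝒜) (l : ℕ) (v : V) : Set (List 𝒜) :=
  {w | ∃ p : GPath G, p.range = v ∧ p.length ≤ l ∧ p.label L = w}

/-- `𝔅̄`: the smallest accommodating set for `(E, L)` (containing the ranges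
`r(α)` for `α ∈ L*(E)` and closed under relative ranges, finite intersections
and finite unions) that is moreover closed under relative complements and
contains `A_sk = A ∩ sinks` for every `A` belonging to it. -/
inductive Bbar (G : DirGraph V E) (L : E → 𝒜) : Set V → Prop
  | base (w : List 𝒜) (hw : IsLabelWord G L w) : Bbar G L (rngW G L w)
  | rel (A : Set V) (w : List 𝒜) (hA : Bbar G L A) (hw : IsLabelWord G L w) :
      Bbar G L (relRng G L A w)
  | inter (A B : Set V) (hA : Bbar G L A) (hB : Bbar G L B) : Bbar G L (A ∩ B)
  | union (A B : Set V) (hA : Bbar G L A) (hB : Bbar G L B) : Bbar G L (A ∪ B)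
  | diff (A B : Set V) (hA : Bbar G L A) (hB : Bbar G L B) : Bbar G L (A \ B)
  | sk (A : Set V) (hA : Bbar G L A) : Bbar G L (A ∩ G.sinks)

/-- The standing assumptions on a labeled space `(E, L, 𝔅̄)`: weakly
left-resolving, set-finite, receiver set-finite, and no sink is a source. -/
structure StandingAssumptions (G : DirGraph V E) (L : E → 𝒜) : Prop where
  wlr : ∀ A B : Set V, Bbar G L A → Bbar G L B → ∀ w : List 𝒜, IsLabelWord G L w →
    relRng G L A w ∩ relRng G L B w = relRng G L (A ∩ B) w
  setFinite : ∀ A : Set V, Bbar G L A → ∀ n : ℕ, 1 ≤ n → (labelsFromLen G L A n).Finite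
  receiverSetFinite : ∀ A : Set V, Bbar G L A → ∀ n : ℕ, 1 ≤ n → (labelsToLen G L n A).Finite
  sinkNotSource : ∀ v ∈ G.sinks, ∃ e, G.rng e = v

/-- The `n`-fold concatenation `w^n` of a word `w`. -/
def wordPow (w : List 𝒜) (n : ℕ) : List 𝒜 := (List.replicate n w).flatten

/-- A labeled path is repeatable if all its powers `w^n`, `n ≥ 1`, are again
labeled paths. -/
def Repeatable (G : DirGraph V E) (L : E → 𝒜) (w : List 𝒜) : Prop :=
  ∀ n : ℕ, 1 ≤ n → IsLabelWord G L (wordPow w n)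

/-- The generalized vertex `[v]_l`: all non-source vertices receiving exactly
the same labeled paths of length at most `l` as `v` does. -/
def gvtx (G : DirGraph V E) (L : E → 𝒜) (l : ℕ) (v : V) : Set V :=
  {u | (∃ e, G.rng e = u) ∧ labelsToLe G L l u = labelsToLe G L l v}

/-- A generalized loop at `A`: a labeled path `α ∈ L(A E^{≥1} A)`. -/
def IsGenLoop (G : DirGraph V E) (L : E → 𝒜) (A : Set V) (α : List 𝒜) : Prop :=
  ∃ p : GPath G, p.label L = α ∧ p.source ∈ A ∧ p.range ∈ A

/-- A loop at `A`: a generalized loop `α` at `A` such that `A ⊆ r(A, α)`. -/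
def IsLoop (G : DirGraph V E) (L : E → 𝒜) (A : Set V) (α : List 𝒜) : Prop :=
  IsGenLoop G L A α ∧ A ⊆ relRng G L A α

/-- The nonempty initial segments (initial paths) of a word `α`. -/
def initialSegs (α : List 𝒜) : Set (List 𝒜) := {w | w ≠ [] ∧ w <+: α}

/-- A loop `α` at `A` has an exit if (i) the initial segments of `α` form a
proper subset of `L(A E^{≤|α|})`, or (ii) `r(A, α_{[1,i]})` contains a sink for
some `1 ≤ i ≤ |α|`, or (iii) `A` is a proper subset of `r(A, α)`. -/
def HasExitLoop (G : DirGraph V E) (L : E → 𝒜) (A : Set V) (α : List 𝒜) : Prop :=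
  initialSegs α ⊂ labelsFromLe G L A α.length ∨
  (∃ k : ℕ, 1 ≤ k ∧ k ≤ α.length ∧ (relRng G L A (α.take k) ∩ G.sinks).Nonempty) ∨
  A ⊂ relRng G L A α

/-- `A_0 E^{≤K} A_1 ⋯ E^{≤K} A_m ≠ ∅`: existence of `m` consecutively
composable paths, each of length between `1` and `K`, the `j`-th going from
`As j` to `As (j+1)`. -/
def ChainExists (G : DirGraph V E) (As : ℕ → Set V) (K m : ℕ) : Prop :=
  ∃ xs : Fin m → GPath G,
    (∀ j : Fin m, (xs j).length ≤ K ∧ (xs j).source ∈ As j.val ∧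
      (xs j).range ∈ As (j.val + 1)) ∧
    ∀ (j : ℕ) (h : j + 1 < m),
      (xs ⟨j, Nat.lt_of_succ_lt h⟩).range = (xs ⟨j + 1, h⟩).source

/-- Same as `ChainExists` but with all paths of length exactly `K`
(i.e. `A_0 E^K A_1 ⋯ E^K A_m ≠ ∅`). -/
def ChainExistsExact (G : DirGraph V E) (As : ℕ → Set V) (K m : ℕ) : Prop :=
  ∃ xs : Fin m → GPath G,
    (∀ j : Fin m, (xs j).length = K ∧ (xs j).source ∈ As j.val ∧
      (xs j).range ∈ As (j.val + 1)) ∧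
    ∀ (j : ℕ) (h : j + 1 < m),
      (xs ⟨j, Nat.lt_of_succ_lt h⟩).range = (xs ⟨j + 1, h⟩).source

/-- Condition (a): for every finite family `A_1, …, A_N` in `𝔅̄` and every
`K ≥ 1` there is `m₀ ≥ 1` such that
`A_{i_1} E^{≤K} A_{i_2} ⋯ E^{≤K} A_{i_n} = ∅` (`n` sets, `n - 1` path factors)
for all `n > m₀` and all choices of indices. -/
def CondA (G : DirGraph V E) (L : E → 𝒜) : Prop :=
  ∀ (N : ℕ) (As : Fin N → Set V), (∀ i, Bbar G L (As i)) → ∀ K : ℕ, 1 ≤ K →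
    ∃ m0 : ℕ, 1 ≤ m0 ∧ ∀ n : ℕ, m0 < n → ∀ ι : ℕ → Fin N,
      ¬ ChainExists G (fun j => As (ι j)) K (n - 1)

/-- A word is agreeable (for level `l`) if it is of the form `β^k β'` with
`β, β' ∈ L(E^{≤l})` and `β'` a nonempty initial segment of `β`. -/
def AgreeableW (G : DirGraph V E) (L : E → 𝒜) (l : ℕ) (α : List 𝒜) : Prop :=
  ∃ (k : ℕ) (β β' : List 𝒜), IsLabelWord G L β ∧ IsLabelWord G L β' ∧
    β.length ≤ l ∧ β' ≠ [] ∧ β' <+: β ∧ α = wordPow β k ++ β'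

/-- A representation of the labeled space `(E, L, 𝔅̄)` in a (C*-)algebra `B`:
projections `p A`, `A ∈ 𝔅̄`, and partial isometries `s a`, `a ∈ 𝒜`, satisfying
the defining relations of a labeled graph C*-algebra. -/
structure LRep (G : DirGraph V E) (L : E → 𝒜) (B : Type*)
    [NonUnitalRing B] [StarRing B] where
  p : Set V → B
  s : 𝒜 → B
  p_empty : p ∅ = 0
  p_sa : ∀ A : Set V, Bbar G L A → star (p A) = p A
  p_mul : ∀ A A' : Set V, Bbar G L A → Bbar G L A' → p A * p A' = p (A ∩ A')
  p_union : ∀ A A' : Set V, Bbar G L A → Bbar G L A' →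
    p (A ∪ A') = p A + p A' - p (A ∩ A')
  s_pi : ∀ a : 𝒜, s a * star (s a) * s a = s a
  p_s : ∀ (A : Set V) (a : 𝒜), Bbar G L A → p A * s a = s a * p (relRng G L A [a])
  s_s : ∀ a : 𝒜, star (s a) * s a = p (rngW G L [a])
  s_orth : ∀ a b : 𝒜, a ≠ b → star (s a) * s b = 0
  ck : ∀ A : Set V, Bbar G L A →
    p A = (∑ᶠ a ∈ {a : 𝒜 | ∃ e, G.src e ∈ A ∧ L e = a},
      s a * p (relRng G L A [a]) * star (s a)) + p (A ∩ G.sinks)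

/-- `s_α` for a word `α`: the product of the partial isometries of its letters
(junk value `0` on the empty word, which is never used). -/
def sWord {B : Type*} [NonUnitalRing B] (s : 𝒜 → B) : List 𝒜 → B
  | [] => 0
  | [a] => s a
  | a :: b :: w => s a * sWord s (b :: w)

/-- The range of a word in `L^#(E)` (`none` is the empty word, with range all
of `E^0`). -/
def owordRng (G : DirGraph V E) (L : E → 𝒜) : Option (List 𝒜) → Set V
  | none => Set.univ
  | some w => rngW G L w

/-- The relative range of a word in `L^#(E)` with respect to `A` (`none` is
the empty word, with `r(A, ε) = A`). -/
def relRngE (G : DirGraph V E) (L : E → 𝒜) (A : Set V) : Option (List 𝒜) → Set V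
  | none => A
  | some w => relRng G L A w

/-- The element `s_α p_A s_β*` of a representation, where `α`, `β` are words in
`L^#(E)` (`none` being the empty word `ε` with `s_ε` the identity). -/
def LRep.elt {B : Type*} [NonUnitalRing B] [StarRing B] {G : DirGraph V E} {L : E → 𝒜}
    (rep : LRep G L B) : Option (List 𝒜) → Set V → Option (List 𝒜) → B
  | none, A, none => rep.p A
  | some α, A, none => sWord rep.s α * rep.p A
  | none, A, some β => rep.p A * star (sWord rep.s β)
  | some α, A, some β => sWord rep.s α * rep.p A * star (sWord rep.s β)

/-- A projection `q` is infinite if there is a partial isometry `u` with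
`u* u = q`, `u u* ≤ q` and `u u* ≠ q`. -/
def IsInfiniteProjection (B : Type*) [NonUnitalRing B] [StarRing B] [PartialOrder B]
    (q : B) : Prop :=
  star q = q ∧ q * q = q ∧ ∃ u : B, star u * u = q ∧ u * star u ≤ q ∧ u * star u ≠ q

/-- A C*-algebra is AF if every finite subset can be approximated within any
`ε > 0` from a finite-dimensional *-subalgebra. -/
def IsAFAlgebra (B : Type*) [NonUnitalNormedRing B] [StarRing B] [NormedSpace ℂ B] : Prop :=
  ∀ (F : Finset B) (ε : ℝ), 0 < ε →
    ∃ D : NonUnitalStarSubalgebra ℂ B, FiniteDimensional ℂ D ∧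
      ∀ x ∈ F, ∃ y ∈ (D : Set B), ‖x - y‖ < ε

/-- A gauge action for a representation: a strongly continuous action of the
circle group by *-automorphisms fixing the projections and scaling the
generating partial isometries. -/
structure GaugeAction {B : Type*} [NonUnitalCStarAlgebra B]
    (G : DirGraph V E) (L : E → 𝒜) (rep : LRep G L B) where
  γ : Circle → B ≃⋆ₐ[ℂ] B
  γ_mul : ∀ z w : Circle, γ (z * w) = (γ w).trans (γ z)
  γ_continuous : ∀ x : B, Continuous fun z => γ z x
  γ_s : ∀ (z : Circle) (a : 𝒜), γ z (rep.s a) = (z : ℂ) • rep.s a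
  γ_p : ∀ (z : Circle) (A : Set V), Bbar G L A → γ z (rep.p A) = rep.p A

/-- The representation generates `B` as a C*-algebra. -/
def GeneratesAlg {B : Type*} [NonUnitalCStarAlgebra B]
    (G : DirGraph V E) (L : E → 𝒜) (rep : LRep G L B) : Prop :=
  closure (NonUnitalStarAlgebra.adjoin ℂ
    ({x : B | ∃ a : 𝒜, x = rep.s a} ∪ {x : B | ∃ A : Set V, Bbar G L A ∧ x = rep.p A}) : Set B)
    = Set.univ

/-- A closed two-sided ideal of a C*-algebra (as a set). -/
def IsClosedTwoSidedIdealSet (B : Type*) [NonUnitalNormedRing B] [NormedSpace ℂ B]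
    (I : Set B) : Prop :=
  IsClosed I ∧ (0 : B) ∈ I ∧ (∀ x ∈ I, ∀ y ∈ I, x + y ∈ I) ∧
    (∀ (c : ℂ), ∀ x ∈ I, c • x ∈ I) ∧ ∀ x ∈ I, ∀ y : B, x * y ∈ I ∧ y * x ∈ I

/-- The closed two-sided ideal generated by an element. -/
def closedIdealGen (B : Type*) [NonUnitalNormedRing B] [NormedSpace ℂ B] (q : B) : Set B :=
  ⋂₀ {I : Set B | IsClosedTwoSidedIdealSet B I ∧ q ∈ I}


lemma hd_mul {B : Type*} [NonUnitalNormedRing B] [NormedSpace ℂ B] [IsScalarTower ℂ B B]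
    [SMulCommClass ℂ B B] {f g : ℝ → B} {f' g' : B} {x : ℝ}
    (hf : HasDerivAt f f' x) (hg : HasDerivAt g g' x) :
    HasDerivAt (fun s => f s * g s) (f' * g x + f x * g') x := by
  have := (ContinuousLinearMap.mul ℝ B).hasDerivAt_of_bilinear (u := f) (v := g)
    (fun _ => hf) (fun _ => hg)
  simpa [add_comm] using this

section AbstractBanach

variable {C : Type*} [NormedRing C] [NormedAlgebra ℂ C]

/-- The regular trace on a finite-dimensional subalgebra. -/
def regTr (D : Subalgebra ℂ C) : D →ₗ[ℂ] ℂ :=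
  (LinearMap.trace ℂ D) ∘ₗ (LinearMap.mul ℂ D)

lemma regTr_comm (D : Subalgebra ℂ C) (x y : D) : regTr D (x * y) = regTr D (y * x) := by
  have h : ∀ a b : D, LinearMap.mul ℂ D (a * b) = LinearMap.mul ℂ D a * LinearMap.mul ℂ D b := by
    intro a b
    ext z
    simp [mul_assoc]
  simp only [regTr, LinearMap.comp_apply]
  rw [h, h, LinearMap.trace_mul_comm]

lemma regTr_one (D : Subalgebra ℂ C) [FiniteDimensional ℂ D] :
    regTr D 1 = Module.finrank ℂ D := by
  have h : LinearMap.mul ℂ D 1 = 1 := by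
    ext z
    simp
  simp only [regTr, LinearMap.comp_apply]
  rw [h, LinearMap.trace_one]

lemma regTr_bound (D : Subalgebra ℂ C) [FiniteDimensional ℂ D] (x : D) :
    ‖regTr D x‖ ≤ Module.finrank ℂ D * ‖(x : C)‖ := by
  simp only [regTr, LinearMap.comp_apply]
  set f : Module.End ℂ D := LinearMap.mul ℂ D x with hf
  rw [Module.End.trace_eq_sum_roots_charpoly_of_splits (IsAlgClosed.splits _)]
  have h1 : ∀ μ ∈ f.charpoly.roots, ‖μ‖ ≤ ‖(x : C)‖ := by
    intro μ hμ
    have hr := (Polynomial.mem_roots'.1 hμ).2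
    rw [← Module.End.hasEigenvalue_iff_isRoot_charpoly] at hr
    obtain ⟨v, hv⟩ := hr.exists_hasEigenvector
    have h2 : x * v = μ • v := hv.apply_eq_smul
    have h3 : (x : C) * (v : C) = μ • (v : C) := by
      have := congrArg (fun z : D => (z : C)) h2
      simpa using this
    have h4 : ‖μ‖ * ‖(v : C)‖ ≤ ‖(x : C)‖ * ‖(v : C)‖ := by
      rw [← norm_smul, ← h3]
      exact norm_mul_le _ _
    have h5 : (v : C) ≠ 0 := by
      intro h
      exact hv.2 (by ext; simpa using h)
    exact le_of_mul_le_mul_right h4 (norm_pos_iff.2 h5)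
  have h2 : Multiset.card f.charpoly.roots ≤ Module.finrank ℂ D := by
    refine (Polynomial.card_roots' _).trans ?_
    rw [LinearMap.charpoly_natDegree]
  calc ‖f.charpoly.roots.sum‖ ≤ (f.charpoly.roots.map fun z => ‖z‖).sum :=
        norm_multiset_sum_le _
    _ ≤ (Multiset.card (f.charpoly.roots.map fun z => ‖z‖)) • ‖(x : C)‖ := by
        refine Multiset.sum_le_card_nsmul _ _ ?_
        intro y hy
        obtain ⟨z, hz, rfl⟩ := Multiset.mem_map.1 hy
        exact h1 z hz
    _ ≤ _ := by
        rw [Multiset.card_map, nsmul_eq_mul]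
        gcongr

/-- Local approximability by finite-dimensional unital subalgebras. -/
def LocFin (C : Type*) [NormedRing C] [NormedAlgebra ℂ C] : Prop :=
  ∀ (F : Finset C) (ε : ℝ), 0 < ε →
    ∃ D : Subalgebra ℂ C, FiniteDimensional ℂ D ∧ ∀ x ∈ F, ∃ y ∈ D, ‖x - y‖ < ε

open Classical in
lemma comm_approx (z : C)
    (hz : z ∈ Submodule.span ℂ {w : C | ∃ x y : C, w = x * y - y * x}) :
    ∃ F : Finset C, ∀ ε : ℝ, 0 < ε → ∃ η : ℝ, 0 < η ∧ ∀ D : Subalgebra ℂ C,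
      (∀ x ∈ F, ∃ y ∈ D, ‖x - y‖ < η) → ∃ z' : D, ‖z - z'‖ < ε ∧ regTr D z' = 0 := by
  induction hz using Submodule.span_induction with
  | mem w hw =>
    obtain ⟨x, y, rfl⟩ := hw
    refine ⟨{x, y}, fun ε hε => ?_⟩
    have hc : Continuous fun q : C × C => q.1 * q.2 - q.2 * q.1 := by fun_prop
    obtain ⟨η, hη, h⟩ := Metric.continuous_iff.1 hc (x, y) ε hε
    refine ⟨η, hη, fun D hD => ?_⟩
    obtain ⟨x', hx', hx⟩ := hD x (by simp)
    obtain ⟨y', hy', hy⟩ := hD y (by simp)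
    refine ⟨⟨x', hx'⟩ * ⟨y', hy'⟩ - ⟨y', hy'⟩ * ⟨x', hx'⟩, ?_, ?_⟩
    · have := h (x', y') (by
        rw [Prod.dist_eq, max_lt_iff, dist_comm, dist_eq_norm, dist_comm, dist_eq_norm]
        exact ⟨hx, hy⟩)
      rw [dist_comm, dist_eq_norm] at this
      simpa using this
    · rw [map_sub, regTr_comm, sub_self]
  | zero =>
    refine ⟨∅, fun ε hε => ⟨1, one_pos, fun D _ => ⟨0, by simpa using hε, map_zero _⟩⟩⟩
  | add a b _ _ ha hb =>
    obtain ⟨F, hF⟩ := ha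
    obtain ⟨F', hF'⟩ := hb
    refine ⟨F ∪ F', fun ε hε => ?_⟩
    obtain ⟨η, hη, h⟩ := hF (ε / 2) (half_pos hε)
    obtain ⟨η', hη', h'⟩ := hF' (ε / 2) (half_pos hε)
    refine ⟨min η η', lt_min hη hη', fun D hD => ?_⟩
    obtain ⟨a', ha', ta⟩ := h D fun x hx => by
      obtain ⟨y, hy, hxy⟩ := hD x (Finset.mem_union_left _ hx)
      exact ⟨y, hy, hxy.trans_le (min_le_left _ _)⟩
    obtain ⟨b', hb', tb⟩ := h' D fun x hx => by
      obtain ⟨y, hy, hxy⟩ := hD x (Finset.mem_union_right _ hx)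
      exact ⟨y, hy, hxy.trans_le (min_le_right _ _)⟩
    refine ⟨a' + b', ?_, by rw [map_add, ta, tb, add_zero]⟩
    have : a + b - ((a' + b' : D) : C) = (a - a') + (b - b') := by
      push_cast
      abel
    rw [this]
    refine (norm_add_le _ _).trans_lt ?_
    linarith
  | smul c a _ ha =>
    obtain ⟨F, hF⟩ := ha
    refine ⟨F, fun ε hε => ?_⟩
    obtain ⟨η, hη, h⟩ := hF (ε / (‖c‖ + 1)) (by positivity)
    refine ⟨η, hη, fun D hD => ?_⟩
    obtain ⟨a', ha', ta⟩ := h D hD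
    refine ⟨c • a', ?_, by rw [map_smul, ta, smul_zero]⟩
    have : c • a - ((c • a' : D) : C) = c • (a - a') := by
      push_cast
      rw [smul_sub]
    rw [this, norm_smul]
    rw [lt_div_iff₀ (by positivity)] at ha'
    nlinarith [norm_nonneg (a - (a' : C)), norm_nonneg c]

lemma exists_trace [Nontrivial C] (hAF : LocFin C) :
    ∃ τ : C →L[ℂ] ℂ, (∀ x y, τ (x * y) = τ (y * x)) ∧ τ 1 ≠ 0 := by
  set S := (Submodule.span ℂ {w : C | ∃ x y : C, w = x * y - y * x}).topologicalClosure with hS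
  have hcl : IsClosed (S : Set C) := Submodule.isClosed_topologicalClosure _
  have h1 : (1 : C) ∉ S := by
    intro h
    have h' : (1 : C) ∈ closure
        (Submodule.span ℂ {w : C | ∃ x y : C, w = x * y - y * x} : Set C) := h
    obtain ⟨z, hz, hd⟩ := Metric.mem_closure_iff.1 h' (1 / 2) (by norm_num)
    obtain ⟨F, hF⟩ := comm_approx z hz
    obtain ⟨η, hη, hD⟩ := hF (1 / 2) (by norm_num)
    obtain ⟨D, hfd, happ⟩ := hAF F η hη
    obtain ⟨z', hz', ht⟩ := hD D happ
    have hn : ‖((1 - z' : D) : C)‖ < 1 := by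
      have : ((1 - z' : D) : C) = (1 - z) + (z - z') := by push_cast; abel
      rw [this]
      rw [dist_eq_norm] at hd
      refine (norm_add_le _ _).trans_lt ?_
      linarith
    have hb := regTr_bound D (1 - z')
    rw [map_sub, ht, sub_zero, regTr_one] at hb
    have hpos : (0 : ℝ) < Module.finrank ℂ D := by
      exact_mod_cast Module.finrank_pos
    rw [Complex.norm_natCast] at hb
    nlinarith
  have := hcl
  have h2 : S.mkQ 1 ≠ 0 := by
    intro h
    exact h1 (by simpa using h)
  obtain ⟨g, -, hg⟩ := exists_dual_vector ℂ (S.mkQ 1) (norm_ne_zero_iff.2 h2)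
  refine ⟨g.comp S.mkQL, ?_, ?_⟩
  · intro x y
    rw [← sub_eq_zero, ← map_sub]
    have : S.mkQ (x * y - y * x) = 0 := by
      simp only [Submodule.mkQ_apply, Submodule.Quotient.mk_eq_zero]
      exact Submodule.le_topologicalClosure _ (Submodule.subset_span ⟨x, y, rfl⟩)
    change g (S.mkQ (x * y - y * x)) = 0
    rw [this, map_zero]
  · change g (S.mkQ 1) ≠ 0
    rw [hg]
    simpa using h2

/-- A periodic flow of contractive automorphisms. -/
structure PFlow (C : Type*) [NormedRing C] [NormedAlgebra ℂ C] where
  γ : ℝ → C →ₐ[ℂ] C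
  norm_le : ∀ s x, ‖γ s x‖ ≤ ‖x‖
  cont : ∀ x, Continuous fun s => γ s x
  add : ∀ s h x, γ (s + h) x = γ s (γ h x)
  zero : ∀ x, γ 0 x = x
  per : ∀ x, γ (2 * Real.pi) x = x

lemma exists_inv_trace [Nontrivial C] (hAF : LocFin C) (Γ : PFlow C) :
    ∃ τ : C →L[ℂ] ℂ, (∀ x y, τ (x * y) = τ (y * x)) ∧ τ 1 ≠ 0 ∧
      ∀ x d, HasDerivAt (fun s => Γ.γ s x) d 0 → τ d = 0 := by
  obtain ⟨τ, ht, h1⟩ := exists_trace hAF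
  have hcont : ∀ x, Continuous fun s => τ (Γ.γ s x) := fun x => τ.continuous.comp (Γ.cont x)
  have hintg : ∀ x, IntervalIntegrable (fun s => τ (Γ.γ s x)) MeasureTheory.volume 0 (2 * Real.pi) :=
    fun x => (hcont x).intervalIntegrable _ _
  let f : C →ₗ[ℂ] ℂ :=
    { toFun := fun x => ∫ s in (0 : ℝ)..(2 * Real.pi), τ (Γ.γ s x)
      map_add' := fun x y => by
        simp only [map_add]
        exact intervalIntegral.integral_add (hintg x) (hintg y)
      map_smul' := fun c x => by
        simp only [map_smul, RingHom.id_apply]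
        exact intervalIntegral.integral_smul c _ }
  let τ' : C →L[ℂ] ℂ := f.mkContinuous (‖τ‖ * |2 * Real.pi - 0|) (fun x => by
    have := intervalIntegral.norm_integral_le_of_norm_le_const (a := 0) (b := 2 * Real.pi)
      (f := fun s => τ (Γ.γ s x)) (C := ‖τ‖ * ‖x‖) (fun s _ =>
        (τ.le_opNorm _).trans (by gcongr; exact Γ.norm_le s x))
    refine this.trans (le_of_eq ?_)
    ring)
  have hτ' : ∀ x, τ' x = ∫ s in (0 : ℝ)..(2 * Real.pi), τ (Γ.γ s x) := fun x => rfl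
  refine ⟨τ', ?_, ?_, ?_⟩
  · intro x y
    simp only [hτ', map_mul]
    congr 1
    ext s
    exact ht _ _
  · simp only [hτ', map_one, intervalIntegral.integral_const]
    rw [smul_ne_zero_iff]
    refine ⟨?_, h1⟩
    have := Real.pi_pos
    simp [this.ne']
  · intro x d hd
    rw [hτ']
    have hder : ∀ s ∈ Set.uIcc (0 : ℝ) (2 * Real.pi),
        HasDerivAt (fun s => τ (Γ.γ s x)) (τ (Γ.γ s d)) s := by
      intro s _
      let Gs : C →L[ℂ] C := (Γ.γ s).toLinearMap.mkContinuous 1 (fun y => by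
        simpa using Γ.norm_le s y)
      have e1 : HasDerivAt (fun u : ℝ => u - s) 1 s := (hasDerivAt_id s).sub_const s
      have e2 : HasDerivAt (fun h => Γ.γ h x) d (s - s) := by simpa using hd
      have e3 : HasDerivAt (fun u => Γ.γ (u - s) x) d s := by
        simpa [Function.comp_def] using HasDerivAt.scomp (h := fun u : ℝ => u - s) s e2 e1
      have e4 := (((τ.comp Gs).restrictScalars ℝ).hasFDerivAt.comp_hasDerivAt s e3)
      have e5 : ∀ u, τ (Γ.γ u x) = (τ.comp Gs) (Γ.γ (u - s) x) := by
        intro u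
        change _ = τ (Γ.γ s (Γ.γ (u - s) x))
        rw [← Γ.add, add_sub_cancel]
      simp only [e5]
      exact e4
    rw [intervalIntegral.integral_eq_sub_of_hasDerivAt hder (hintg d)]
    simp [Γ.zero, Γ.per]

lemma trace_pow (Γ : PFlow C) (τ : C →L[ℂ] ℂ)
    (ht : ∀ x y, τ (x * y) = τ (y * x))
    (hδ : ∀ x d, HasDerivAt (fun s => Γ.γ s x) d 0 → τ d = 0) (x d : C)
    (hd : HasDerivAt (fun s => Γ.γ s x) d 0) (m : ℕ) : τ (x ^ m * d) = 0 := by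
  have key : ∀ m : ℕ, ∃ e, HasDerivAt (fun s => Γ.γ s (x ^ m)) e 0 ∧
      ∀ k : ℕ, τ (x ^ (k + 1) * e) = m * τ (x ^ (k + m) * d) := by
    intro m
    induction m with
    | zero =>
      refine ⟨0, ?_, by simp⟩
      simp only [pow_zero, map_one]
      exact hasDerivAt_const _ _
    | succ m ih =>
      obtain ⟨e, he, h⟩ := ih
      refine ⟨e * x + x ^ m * d, ?_, fun k => ?_⟩
      · simp only [pow_succ, map_mul]
        simpa [Γ.zero] using hd_mul he hd
      · rw [mul_add, map_add, ← mul_assoc, ht (x ^ (k + 1) * e) x, ← mul_assoc, ← pow_succ',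
          h (k + 1), ← mul_assoc, ← pow_add]
        have : k + 1 + m = k + (m + 1) := by ring
        rw [this]
        push_cast
        ring
  obtain ⟨e, he, h⟩ := key m
  have h1 : HasDerivAt (fun s => Γ.γ s (x ^ m * x)) (e * x + x ^ m * d) 0 := by
    simp only [map_mul]
    simpa [Γ.zero] using hd_mul he hd
  have h2 := hδ _ _ h1
  have h3 := h 0
  rw [map_add, ht e x] at h2
  simp only [zero_add, pow_one] at h3
  rw [h3] at h2
  have h4 : ((m : ℂ) + 1) * τ (x ^ m * d) = 0 := by rw [← h2]; ring
  rcases mul_eq_zero.1 h4 with h5 | h5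
  · exact absurd h5 (Nat.cast_add_one_ne_zero m)
  · exact h5

lemma trace_resolvent_large [CompleteSpace C] [NormOneClass C] (τ : C →L[ℂ] ℂ) (x d : C)
    (h0 : ∀ m : ℕ, τ (x ^ m * d) = 0) (ζ : ℂ) (hζ : ‖x‖ < ‖ζ‖) :
    τ (resolvent x ζ * d) = 0 := by
  have hζ0 : ζ ≠ 0 := by
    intro h
    rw [h, norm_zero] at hζ
    exact absurd hζ (not_lt.2 (norm_nonneg _))
  have hn : ‖ζ⁻¹ • x‖ < 1 := by
    rw [norm_smul, norm_inv, inv_mul_lt_iff₀ (norm_pos_iff.2 hζ0)]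
    simpa using hζ
  have hs := (summable_geometric_of_norm_lt_one hn).hasSum
  set y := ∑' i : ℕ, (ζ⁻¹ • x) ^ i with hy
  have hy1 : (1 - ζ⁻¹ • x) * y = 1 := mul_neg_geom_series _ hn
  have hy2 : y * (1 - ζ⁻¹ • x) = 1 := geom_series_mul_neg _ hn
  have hz : algebraMap ℂ C ζ - x = ζ • (1 - ζ⁻¹ • x) := by
    rw [smul_sub, smul_smul, mul_inv_cancel₀ hζ0, one_smul, Algebra.algebraMap_eq_smul_one]
  have hr : resolvent x ζ = ζ⁻¹ • y := by
    unfold resolvent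
    let u : Cˣ := ⟨algebraMap ℂ C ζ - x, ζ⁻¹ • y, by
      rw [hz, smul_mul_smul_comm, hy1, mul_inv_cancel₀ hζ0, one_smul], by
      rw [hz, smul_mul_smul_comm, hy2, inv_mul_cancel₀ hζ0, one_smul]⟩
    exact Ring.inverse_unit u
  rw [hr, smul_mul_assoc, map_smul]
  have h2 : HasSum (fun i : ℕ => τ ((ζ⁻¹ • x) ^ i * d)) (τ (y * d)) :=
    τ.hasSum (hs.mul_right d)
  have h3 : (fun i : ℕ => τ ((ζ⁻¹ • x) ^ i * d)) = fun _ => 0 := by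
    ext i
    rw [smul_pow, smul_mul_assoc, map_smul, h0, smul_zero]
  rw [h3] at h2
  rw [h2.unique hasSum_zero, smul_zero]

lemma trace_ray [CompleteSpace C] [NormOneClass C] (τ : C →L[ℂ] ℂ) (x d : C)
    (h0 : ∀ m : ℕ, τ (x ^ m * d) = 0) (ω : ℂ) (hω : ω ≠ 0)
    (hray : ∀ r : ℝ, 0 ≤ r → (r : ℂ) * ω ∈ resolventSet ℂ x) (xi : C) (h1 : x * xi = 1)
    (h2 : xi * x = 1) : τ (xi * d) = 0 := by
  set f : ℂ → ℂ := fun ζ => τ (resolvent x ζ * d) with hf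
  have hd : DifferentiableOn ℂ f (resolventSet ℂ x) := by
    intro ζ hζ
    have := (spectrum.hasDerivAt_resolvent_const_left (a := x) hζ).differentiableAt
    exact (τ.differentiableAt.comp ζ (this.mul_const d)).differentiableWithinAt
  have ha := hd.analyticOnNhd (spectrum.isOpen_resolventSet x)
  set R : Set ℂ := (fun r : ℝ => (r : ℂ) * ω) '' Set.Ici 0 with hR
  have hRs : R ⊆ resolventSet ℂ x := by
    rintro _ ⟨r, hr, rfl⟩
    exact hray r hr
  have hpre : IsPreconnected R :=
    isPreconnected_Ici.image _ (by fun_prop)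
  set r₀ : ℝ := (‖x‖ + 1) / ‖ω‖ with hr₀
  have hr₀p : 0 ≤ r₀ := by positivity
  have hωp : 0 < ‖ω‖ := norm_pos_iff.2 hω
  have hev : f =ᶠ[nhds ((r₀ : ℂ) * ω)] 0 := by
    have : ∀ᶠ ζ in nhds ((r₀ : ℂ) * ω), ‖x‖ < ‖ζ‖ := by
      refine (continuous_norm.continuousAt).eventually_const_lt ?_
      change ‖x‖ < ‖(r₀ : ℂ) * ω‖
      rw [norm_mul, Complex.norm_real, Real.norm_of_nonneg hr₀p, hr₀, div_mul_cancel₀ _ hωp.ne']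
      linarith
    filter_upwards [this] with ζ hζ
    exact trace_resolvent_large τ x d h0 ζ hζ
  have hz := (ha.mono hRs).eqOn_zero_of_preconnected_of_eventuallyEq_zero hpre
    ⟨r₀, hr₀p, rfl⟩ hev
  have h3 : f 0 = 0 := hz ⟨0, by simp, by simp⟩
  have h4 : resolvent x (0 : ℂ) = -xi := by
    unfold resolvent
    let u : Cˣ := ⟨algebraMap ℂ C 0 - x, -xi, by simp [h1], by simp [h2]⟩
    exact Ring.inverse_unit u
  simp only [hf, h4, neg_mul, map_neg, neg_eq_zero] at h3
  exact h3

lemma isAlgebraic_of_mem (D : Subalgebra ℂ C) [FiniteDimensional ℂ D] (y : C) (hy : y ∈ D) :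
    (spectrum ℂ y).Finite := by
  have hi : IsIntegral ℂ (⟨y, hy⟩ : D) := Algebra.IsIntegral.isIntegral _
  obtain ⟨q, hq, hq0⟩ := hi
  have h0 : Polynomial.aeval y q = 0 := by
    have h1 : Polynomial.aeval (⟨y, hy⟩ : D) q = 0 := hq0
    have h2 := congrArg D.val h1
    rw [← Polynomial.aeval_algHom_apply] at h2
    simpa using h2
  by_cases hn : Nontrivial C
  · refine (q.roots.toFinset.finite_toSet).subset ?_
    intro μ hμ
    have := spectrum.subset_polynomial_aeval y q ⟨μ, hμ, rfl⟩
    rw [h0, spectrum.zero_eq] at this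
    simpa [hq.ne_zero] using this
  · rw [not_nontrivial_iff_subsingleton] at hn
    rw [spectrum.of_subsingleton]
    exact Set.finite_empty

lemma exists_ray (y : C) (hfin : (spectrum ℂ y).Finite) (h0 : (0 : ℂ) ∈ resolventSet ℂ y) :
    ∃ ω : ℂ, ω ≠ 0 ∧ ∀ r : ℝ, 0 ≤ r → (r : ℂ) * ω ∈ resolventSet ℂ y := by
  have hf : ((fun l : ℂ => l.im / l.re) '' spectrum ℂ y).Finite := hfin.image _
  obtain ⟨_, ⟨k, rfl⟩, hk⟩ :=
    (Set.infinite_range_of_injective (Nat.cast_injective (R := ℝ))).exists_notMem_finite hf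
  refine ⟨⟨1, k⟩, ?_, ?_⟩
  · intro h
    simpa using congrArg Complex.re h
  · intro r hr
    by_contra hc
    rcases hr.eq_or_lt with h | h
    · apply hc
      rw [← h]
      simpa using h0
    · apply hk
      refine ⟨_, hc, ?_⟩
      simp
      field_simp

lemma ray_open [CompleteSpace C] [NormOneClass C] (y : C) (ω : ℂ) (hω : ω ≠ 0)
    (hray : ∀ r : ℝ, 0 ≤ r → (r : ℂ) * ω ∈ resolventSet ℂ y) :
    ∀ᶠ z in nhds y, ∀ r : ℝ, 0 ≤ r → (r : ℂ) * ω ∈ resolventSet ℂ z := by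
  have hωp : 0 < ‖ω‖ := norm_pos_iff.2 hω
  set R : ℝ := (‖y‖ + 1) / ‖ω‖ with hR
  have h1 : ∀ᶠ z in nhds y, ‖z‖ < ‖y‖ + 1 :=
    (continuous_norm.continuousAt).eventually_lt_const (lt_add_one _)
  have h2 : ∀ᶠ z in nhds y, ∀ r ∈ Set.Icc (0 : ℝ) R, (r : ℂ) * ω ∈ resolventSet ℂ z := by
    refine isCompact_Icc.eventually_forall_of_forall_eventually ?_
    intro r hr
    have hc : Continuous fun q : C × ℝ => algebraMap ℂ C ((q.2 : ℂ) * ω) - q.1 := by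
      have := continuous_algebraMap ℂ C
      fun_prop
    exact (hc.continuousAt (x := (y, r))).eventually (Units.isOpen.mem_nhds (hray r hr.1))
  filter_upwards [h1, h2] with z hz1 hz2 r hr
  by_cases hrR : r ≤ R
  · exact hz2 r ⟨hr, hrR⟩
  · refine spectrum.mem_resolventSet_of_norm_lt ?_
    rw [norm_mul, Complex.norm_real, Real.norm_of_nonneg hr]
    have : ‖y‖ + 1 < r * ‖ω‖ := by
      rw [not_le, hR, div_lt_iff₀ hωp] at hrR
      exact hrR
    linarith

lemma isUnit_of_near_one [CompleteSpace C] (w : C) (h : ‖1 - w‖ < 1) : IsUnit w := by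
  have := (Units.oneSub (1 - w) h).isUnit
  simpa using this

theorem abstract_contra [CompleteSpace C] [NormOneClass C] [Nontrivial C] (hAF : LocFin C)
    (Γ : PFlow C) (hdense : Dense {x : C | ∃ d, HasDerivAt (fun s => Γ.γ s x) d 0})
    (t t' : C) (htt : t' * t = 1) (ht' : ‖t'‖ ≤ 1) (n : ℕ) (hn : n ≠ 0)
    (hΓ : ∀ s : ℝ, Γ.γ s t' = Complex.exp (-(n * (s * Complex.I))) • t') : False := by
  obtain ⟨τ, htr, hτ1, hτδ⟩ := exists_inv_trace hAF Γ
  obtain ⟨D, hfd, hD⟩ := hAF {t} 1 one_pos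
  obtain ⟨y, hy, hty⟩ := hD t (by simp)
  have hnear : ∀ z : C, ‖t - z‖ < 1 → ‖1 - t' * z‖ < 1 := by
    intro z hz
    have : 1 - t' * z = t' * (t - z) := by rw [mul_sub, htt]
    rw [this]
    refine (norm_mul_le _ _).trans_lt ?_
    nlinarith [norm_nonneg (t - z), norm_nonneg t']
  -- `y` is invertible
  have hyu : IsUnit y := by
    obtain ⟨u, hu⟩ := isUnit_of_near_one _ (hnear y hty)
    have hl : (↑u⁻¹ * t') * y = 1 := by rw [mul_assoc, ← hu, Units.inv_mul]
    have hinj : Function.Injective (LinearMap.mulLeft ℂ (⟨y, hy⟩ : D)) := by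
      intro a b hab
      have h1 : y * (a : C) = y * (b : C) := congrArg (fun z : D => (z : C)) hab
      have h2 : (↑u⁻¹ * t') * (y * (a : C)) = (↑u⁻¹ * t') * (y * (b : C)) := by rw [h1]
      rw [← mul_assoc, ← mul_assoc, hl, one_mul, one_mul] at h2
      exact Subtype.ext h2
    obtain ⟨z, hz⟩ := (LinearMap.injective_iff_surjective.1 hinj) 1
    have hz' : y * (z : C) = 1 := congrArg (fun z : D => (z : C)) hz
    have hlz : (↑u⁻¹ * t') = (z : C) := left_inv_eq_right_inv hl hz'
    exact ⟨⟨y, z, hz', by rw [← hlz, hl]⟩, rfl⟩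
  have h0 : (0 : ℂ) ∈ resolventSet ℂ y := by
    rw [spectrum.mem_resolventSet_iff]
    simpa using hyu
  obtain ⟨ω, hω, hray⟩ := exists_ray y (isAlgebraic_of_mem D y hy) h0
  have hev := ray_open y ω hω hray
  have hev2 : ∀ᶠ z in nhds y, ‖t - z‖ < 1 := by
    have : Continuous fun z => ‖t - z‖ := by fun_prop
    exact this.continuousAt.eventually_lt_const hty
  obtain ⟨z, ⟨hz1, hz2⟩, d, hd⟩ := (mem_closure_iff_nhds.1 (hdense y)) _ (hev.and hev2)
  have hzu : IsUnit z := by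
    have := hz1 0 le_rfl
    rw [spectrum.mem_resolventSet_iff] at this
    simpa using this
  obtain ⟨v, rfl⟩ := hzu
  have e1 : τ (↑v⁻¹ * d) = 0 :=
    trace_ray τ v d (trace_pow Γ τ htr hτδ _ d hd) ω hω hz1 _ v.mul_inv v.inv_mul
  -- `w = t' z`
  have hw := hnear v hz2
  have hwu := isUnit_of_near_one _ hw
  have ht'u : IsUnit t' := by simpa using hwu.mul v⁻¹.isUnit
  have htt' : t * t' = 1 := by
    obtain ⟨a, rfl⟩ := ht'u
    have : t = ↑a⁻¹ := by
      rw [← one_mul t, ← a.inv_mul, mul_assoc, htt, mul_one]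
    rw [this, a.inv_mul]
  have hdt : HasDerivAt (fun s => Γ.γ s t') (-(n * Complex.I) • t') 0 := by
    simp only [hΓ]
    have h1 : HasDerivAt (fun s : ℝ => Complex.exp (-(n * (s * Complex.I))))
        (-(n * Complex.I)) 0 := by
      have h2 : HasDerivAt (fun s : ℝ => -((n : ℂ) * ((s : ℂ) * Complex.I)))
          (-((n : ℂ) * ((1 : ℂ) * Complex.I))) (0 : ℝ) := by
        have h3 : HasDerivAt (fun s : ℝ => (s : ℂ)) 1 (0 : ℝ) := Complex.ofRealCLM.hasDerivAt
        exact ((h3.mul_const Complex.I).const_mul (n : ℂ)).neg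
      have h4 := h2.cexp
      simpa using h4
    exact h1.smul_const t'
  have hdw := hd_mul hdt hd
  simp only [← map_mul, Γ.zero] at hdw
  have e2 : τ ((↑v⁻¹ * t) * (-(n * Complex.I) • t' * (v : C) + t' * d)) = 0 := by
    refine trace_ray τ (t' * v) _ (trace_pow Γ τ htr hτδ _ _ hdw) (-1) (by simp) ?_ _ ?_ ?_
    · intro r hr
      rw [spectrum.mem_resolventSet_iff]
      have hr1 : (0 : ℝ) < 1 + r := by linarith
      have hr1c : ((1 + r : ℝ) : ℂ) ≠ 0 := by exact_mod_cast hr1.ne'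
      have h1 : IsUnit (1 - ((1 + r : ℝ) : ℂ)⁻¹ • (1 - t' * (v : C))) := by
        refine isUnit_of_near_one _ ?_
        rw [sub_sub_cancel, norm_smul, norm_inv, Complex.norm_real, Real.norm_of_nonneg hr1.le,
          inv_mul_lt_iff₀ hr1]
        linarith
      have h2 : algebraMap ℂ C ((r : ℂ) * -1) - t' * (v : C)
          = (-((1 + r : ℝ) : ℂ)) • (1 - ((1 + r : ℝ) : ℂ)⁻¹ • (1 - t' * (v : C))) := by
        rw [smul_sub, smul_smul, neg_mul, mul_inv_cancel₀ hr1c, Algebra.algebraMap_eq_smul_one]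
        push_cast
        module
      rw [h2]
      have := (h1.smul (Units.mk0 _ (neg_ne_zero.2 hr1c)))
      exact this
    · rw [mul_assoc, ← mul_assoc (v : C), v.mul_inv, one_mul, htt]
    · rw [mul_assoc, ← mul_assoc t, htt', one_mul, v.inv_mul]
  rw [mul_add, map_add, mul_assoc (↑v⁻¹ : C) t, mul_assoc (↑v⁻¹ : C) t (t' * d), ← mul_assoc t t' d, htt', one_mul, e1, add_zero,
    smul_mul_assoc, mul_smul_comm, ← mul_assoc t, htt', one_mul, mul_smul_comm, v.inv_mul,
    map_smul, smul_eq_zero] at e2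
  rcases e2 with h | h
  · simp [hn] at h
  · exact hτ1 h

end AbstractBanach

section CornerPart

variable {B : Type*} [NonUnitalCStarAlgebra B]

/-- A nonzero projection. -/
structure NZProj (B : Type*) [NonUnitalCStarAlgebra B] where
  p : B
  sa : star p = p
  idem : p * p = p
  ne : p ≠ 0

/-- The corner `pBp`. -/
def Cnr (P : NZProj B) : NonUnitalSubalgebra ℂ B where
  carrier := {x | P.p * x = x ∧ x * P.p = x}
  add_mem' := by
    rintro a b ⟨h1, h2⟩ ⟨h3, h4⟩
    exact ⟨by rw [mul_add, h1, h3], by rw [add_mul, h2, h4]⟩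
  zero_mem' := ⟨mul_zero _, zero_mul _⟩
  mul_mem' := by
    rintro a b ⟨h1, h2⟩ ⟨h3, h4⟩
    exact ⟨by rw [← mul_assoc, h1], by rw [mul_assoc, h4]⟩
  smul_mem' := by
    rintro c a ⟨h1, h2⟩
    exact ⟨by rw [mul_smul_comm, h1], by rw [smul_mul_assoc, h2]⟩

lemma mem_Cnr (P : NZProj B) (x : B) : x ∈ Cnr P ↔ P.p * x = x ∧ x * P.p = x := Iff.rfl

lemma NZProj.norm_p (P : NZProj B) : ‖P.p‖ = 1 := by
  have h : ‖star P.p * P.p‖ = ‖P.p‖ * ‖P.p‖ := CStarRing.norm_star_mul_self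
  rw [P.sa, P.idem] at h
  have h2 : ‖P.p‖ ≠ 0 := norm_ne_zero_iff.2 P.ne
  field_simp at h
  exact h.symm

instance (P : NZProj B) : NormedRing (Cnr P) :=
  { (inferInstance : NonUnitalNormedRing (Cnr P)) with
    one := ⟨P.p, P.idem, P.idem⟩
    one_mul := fun a => Subtype.ext a.2.1
    mul_one := fun a => Subtype.ext a.2.2 }

lemma Cnr.coe_one (P : NZProj B) : ((1 : Cnr P) : B) = P.p := rfl
lemma Cnr.coe_mul (P : NZProj B) (x y : Cnr P) : ((x * y : Cnr P) : B) = x * y := rfl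
lemma Cnr.coe_add (P : NZProj B) (x y : Cnr P) : ((x + y : Cnr P) : B) = x + y := rfl
lemma Cnr.coe_sub (P : NZProj B) (x y : Cnr P) : ((x - y : Cnr P) : B) = x - y := rfl
lemma Cnr.norm_coe (P : NZProj B) (x : Cnr P) : ‖(x : B)‖ = ‖x‖ := rfl

instance (P : NZProj B) : Algebra ℂ (Cnr P) :=
  Algebra.ofModule (fun r x y => Subtype.ext (smul_mul_assoc r (x : B) (y : B)))
    (fun r x y => Subtype.ext (mul_smul_comm r (x : B) (y : B)))

lemma Cnr.coe_smul (P : NZProj B) (c : ℂ) (x : Cnr P) : ((c • x : Cnr P) : B) = c • (x : B) := rfl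

instance (P : NZProj B) : NormedAlgebra ℂ (Cnr P) where
  norm_smul_le c x := (norm_smul_le c (x : B))

instance (P : NZProj B) : NormOneClass (Cnr P) := ⟨P.norm_p⟩

instance (P : NZProj B) : Nontrivial (Cnr P) :=
  ⟨⟨1, 0, fun h => P.ne (congrArg Subtype.val h)⟩⟩

instance (P : NZProj B) : CompleteSpace (Cnr P) := by
  have : IsClosed (Cnr P : Set B) := by
    have h : (Cnr P : Set B) = {x | P.p * x = x} ∩ {x | x * P.p = x} := rfl
    rw [h]
    exact (isClosed_eq (by fun_prop) (by fun_prop)).inter (isClosed_eq (by fun_prop) (by fun_prop))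
  exact this.completeSpace_coe

/-- A projection in a finite-dimensional star subalgebra close to a given projection. -/
lemma exists_proj_near (P : NZProj B) (ε : ℝ) (hε : 0 < ε) :
    ∃ η : ℝ, 0 < η ∧ ∀ D : NonUnitalStarSubalgebra ℂ B, FiniteDimensional ℂ D →
      (∃ d ∈ D, ‖P.p - d‖ < η) → ∃ q ∈ D, star q = q ∧ q * q = q ∧ ‖q - P.p‖ < ε := by
  set δ : ℝ := min (1 / 4) (ε / 4) with hδ
  have hδp : 0 < δ := lt_min (by norm_num) (by linarith)
  have hcont : Continuous fun d : B => d * d - d := by fun_prop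
  obtain ⟨η₁, hη₁, h1⟩ := Metric.continuous_iff.1 hcont P.p (δ / 2) (by linarith)
  refine ⟨min η₁ (ε / 4), lt_min hη₁ (by linarith), ?_⟩
  rintro D hfd ⟨d₀, hd₀, hdd₀⟩
  set d : B := (1 / 2 : ℂ) • (d₀ + star d₀) with hd
  have hdD : d ∈ D := SMulMemClass.smul_mem _ (add_mem hd₀ (star_mem hd₀))
  have hdsa : IsSelfAdjoint d := by
    rw [hd, IsSelfAdjoint, star_smul, star_add, star_star, add_comm]
    simp
  have hdp : ‖P.p - d‖ < min η₁ (ε / 4) := by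
    have e : P.p - d = (1 / 2 : ℂ) • ((P.p - d₀) + star (P.p - d₀)) := by
      rw [hd, star_sub, P.sa]
      module
    rw [e, norm_smul]
    have := norm_add_le (P.p - d₀) (star (P.p - d₀))
    rw [norm_star] at this
    norm_num at *
    constructor <;> linarith
  have h2 : ‖d * d - d‖ < δ / 2 := by
    have := h1 d (by
      rw [dist_comm, dist_eq_norm]
      exact hdp.trans_le (min_le_left _ _))
    rw [P.idem, sub_self, dist_zero_right] at this
    exact this
  have hspec : ∀ x ∈ quasispectrum ℝ d, |x * x - x| < δ / 2 := by
    intro x hx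
    have := norm_apply_le_norm_cfcₙ (fun x : ℝ => x * x - x) d hx (by fun_prop) (by simp) hdsa
    have e : cfcₙ (fun x : ℝ => x * x - x) d = d * d - d := by
      rw [cfcₙ_sub (fun x : ℝ => x * x) (fun x => x) d, cfcₙ_mul (fun x : ℝ => x) (fun x => x) d,
        cfcₙ_id' ℝ d]
    rw [e] at this
    exact this.trans_lt h2
  set f : ℝ → ℝ := fun x => if x ≤ 1 / 2 then 0 else 1 with hf
  have hδ4 : δ ≤ 1 / 4 := min_le_left _ _
  have hne : ∀ x ∈ quasispectrum ℝ d, x ≠ 1 / 2 := by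
    intro x hx h
    have := hspec x hx
    rw [h] at this
    norm_num at this
    linarith
  have hfc : ContinuousOn f (quasispectrum ℝ d) := by
    intro x hx
    apply ContinuousAt.continuousWithinAt
    rcases lt_or_gt_of_ne (hne x hx) with h | h
    · have : f =ᶠ[nhds x] fun _ => 0 := by
        filter_upwards [Iio_mem_nhds h] with y hy
        simp only [hf]
        rw [if_pos (le_of_lt hy)]
      exact continuousAt_const.congr this.symm
    · have : f =ᶠ[nhds x] fun _ => 1 := by
        filter_upwards [Ioi_mem_nhds h] with y hy
        simp only [hf]
        rw [if_neg (not_le.2 hy)]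
      exact continuousAt_const.congr this.symm
  have hf0 : f 0 = 0 := by simp [hf]
  have hclosed : IsClosed (D : Set B) := by
    have : FiniteDimensional ℂ D.toNonUnitalSubalgebra.toSubmodule := hfd
    exact Submodule.closed_of_finiteDimensional D.toNonUnitalSubalgebra.toSubmodule
  refine ⟨cfcₙ f d, ?_, ?_, ?_, ?_⟩
  · exact cfcₙ_mem (𝕜' := ℂ) f hdD
  · exact cfcₙ_predicate f d
  · rw [← cfcₙ_mul f f d hfc hf0 hfc hf0]
    congr 1
    ext x
    simp only [hf]
    split_ifs <;> simp
  · have e : ‖cfcₙ f d - d‖ ≤ δ * 2 := by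
      nth_rewrite 2 [← cfcₙ_id' ℝ d]
      rw [← cfcₙ_sub f (fun x => x) d hfc hf0]
      refine norm_cfcₙ_le ?_
      intro x hx
      have h3 := abs_lt.1 (hspec x hx)
      rw [Real.norm_eq_abs, abs_le]
      simp only [hf]
      split_ifs with h
      · constructor <;> nlinarith
      · push Not at h
        constructor <;> nlinarith
    have e2 : cfcₙ f d - P.p = (cfcₙ f d - d) - (P.p - d) := by abel
    rw [e2]
    refine (norm_sub_le _ _).trans_lt ?_
    have := hdp.trans_le (min_le_right _ _)
    have : δ ≤ ε / 4 := min_le_right _ _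
    linarith


/-- The finite-dimensional subalgebra of the corner obtained by conjugating `qDq`. -/
lemma exists_sub (P : NZProj B) (D : NonUnitalStarSubalgebra ℂ B) (hfd : FiniteDimensional ℂ D)
    (q : B) (hqD : q ∈ D) (hq : q * q = q) (hqn : ‖q‖ ≤ 1) (δ : ℝ) (hδ : δ ≤ 1 / 8)
    (hqp : ‖q - P.p‖ ≤ δ) :
    ∃ b : B, ‖b - P.p‖ ≤ 2 * δ ∧ ∃ D' : Subalgebra ℂ (Cnr P), FiniteDimensional ℂ D' ∧
      ∀ y ∈ D, ∃ z ∈ D', (z : B) = b * q * y * q * P.p := by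
  have hpn := P.norm_p
  have hpp := P.idem
  set a : Cnr P := ⟨P.p * q * P.p, by rw [← mul_assoc, ← mul_assoc, hpp],
    by rw [mul_assoc _ P.p P.p, hpp]⟩ with ha
  have ha1 : ‖1 - a‖ ≤ δ := by
    rw [← Cnr.norm_coe, Cnr.coe_sub, Cnr.coe_one]
    change ‖P.p - P.p * q * P.p‖ ≤ δ
    have : P.p - P.p * q * P.p = -(P.p * (q - P.p) * P.p) := by
      rw [mul_sub, sub_mul, hpp, hpp]
      abel
    rw [this, norm_neg]
    calc ‖P.p * (q - P.p) * P.p‖ ≤ ‖P.p‖ * ‖q - P.p‖ * ‖P.p‖ := norm_mul₃_le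
      _ ≤ δ := by rw [hpn]; simpa using hqp
  obtain ⟨u, hu⟩ := isUnit_of_near_one a (lt_of_le_of_lt ha1 (by linarith))
  set bc : Cnr P := ↑u⁻¹ with hbc
  have hba : bc * a = 1 := by rw [← hu, hbc, u.inv_mul]
  have hb1 : bc - 1 = bc * (1 - a) := by rw [mul_sub, hba, mul_one]
  have hb2 : ‖bc - 1‖ ≤ ‖bc‖ * δ := by
    rw [hb1]
    exact (norm_mul_le _ _).trans (by gcongr)
  have hδ0 : 0 ≤ δ := (norm_nonneg _).trans hqp
  have hb3 : ‖bc‖ ≤ 2 := by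
    have h1 : ‖bc‖ ≤ ‖bc - 1‖ + 1 := by
      have := norm_add_le (bc - 1) 1
      rwa [sub_add_cancel, norm_one] at this
    nlinarith [norm_nonneg bc]
  have hb4 : ‖bc - 1‖ ≤ 2 * δ := hb2.trans (by gcongr)
  set b : B := (bc : B) with hb
  have hpb : P.p * b = b := bc.2.1
  have hbp : b * P.p = b := bc.2.2
  have hb4' : ‖b - P.p‖ ≤ 2 * δ := hb4
  have hbn : ‖b‖ ≤ 2 := hb3
  have hbqp : b * q * P.p = P.p := by
    have h1 : b * (P.p * q * P.p) = P.p := congrArg Subtype.val hba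
    rw [← mul_assoc, ← mul_assoc, hbp] at h1
    exact h1
  -- the idempotent `q b q` equals `q`
  have hqbq : q * b * q = q := by
    set e := q - q * b * q with he
    have hx : q * b * q * (q * b * q) = q * b * q := by
      calc q * b * q * (q * b * q) = q * b * (q * q) * b * q := by simp only [mul_assoc]
        _ = q * b * q * (P.p * b) * q := by rw [hq, hpb]
        _ = q * (b * q * P.p) * b * q := by simp only [mul_assoc]
        _ = q * (P.p * b) * q := by rw [hbqp]; simp only [mul_assoc]
        _ = q * b * q := by rw [hpb]
    have hqe : q * (q * b * q) = q * b * q := by rw [← mul_assoc, ← mul_assoc, hq]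
    have heq : (q * b * q) * q = q * b * q := by rw [mul_assoc, hq]
    have hee : e * e = e := by
      rw [he, mul_sub, sub_mul, sub_mul, hq, hqe, heq, hx]
      abel
    have hen : ‖e‖ < 1 := by
      have h1 : e = q * ((q - P.p) - (b - P.p)) * q := by
        rw [he, sub_sub_sub_cancel_right, mul_sub, sub_mul, hq, hq]
      rw [h1]
      have h2 : ‖(q - P.p) - (b - P.p)‖ ≤ 3 * δ := (norm_sub_le _ _).trans (by linarith)
      calc ‖q * ((q - P.p) - (b - P.p)) * q‖
          ≤ ‖q‖ * ‖(q - P.p) - (b - P.p)‖ * ‖q‖ := norm_mul₃_le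
        _ ≤ 1 * (3 * δ) * 1 := by gcongr
        _ < 1 := by linarith
    have he0 : ‖e‖ ≤ ‖e‖ * ‖e‖ := by
      conv_lhs => rw [← hee]
      exact norm_mul_le _ _
    have he1 : ‖e‖ = 0 := by nlinarith [norm_nonneg e]
    have he2 : q - q * b * q = 0 := norm_eq_zero.1 he1
    exact (sub_eq_zero.1 he2).symm
  have hmul : ∀ y y' : B, (b * (q * y * q) * P.p) * (b * (q * y' * q) * P.p)
      = b * (q * (y * q * y') * q) * P.p := by
    intro y y'
    calc (b * (q * y * q) * P.p) * (b * (q * y' * q) * P.p)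
        = b * (q * y * q) * (P.p * b) * (q * y' * q) * P.p := by simp only [mul_assoc]
      _ = b * (q * y * (q * b * q) * y' * q) * P.p := by rw [hpb]; simp only [mul_assoc]
      _ = _ := by rw [hqbq]; simp only [mul_assoc]
  let D' : Subalgebra ℂ (Cnr P) :=
    { carrier := {z | ∃ y ∈ D, (z : B) = b * (q * y * q) * P.p}
      mul_mem' := by
        rintro z z' ⟨y, hy, h⟩ ⟨y', hy', h'⟩
        refine ⟨y * q * y', mul_mem (mul_mem hy hqD) hy', ?_⟩
        rw [Cnr.coe_mul, h, h', hmul]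
      add_mem' := by
        rintro z z' ⟨y, hy, h⟩ ⟨y', hy', h'⟩
        refine ⟨y + y', add_mem hy hy', ?_⟩
        rw [Cnr.coe_add, h, h']
        simp only [mul_add, add_mul]
      algebraMap_mem' := by
        intro c
        refine ⟨c • q, SMulMemClass.smul_mem _ hqD, ?_⟩
        rw [Algebra.algebraMap_eq_smul_one, Cnr.coe_smul, Cnr.coe_one]
        simp only [mul_smul_comm, smul_mul_assoc]
        rw [hq, hq, hbqp] }
  refine ⟨b, hb4', D', ?_, ?_⟩
  · let φ : B →ₗ[ℂ] B :=
      { toFun := fun y => b * (q * y * q) * P.p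
        map_add' := by intro x y; simp only [mul_add, add_mul]
        map_smul' := by intro c x; simp only [mul_smul_comm, smul_mul_assoc, RingHom.id_apply] }
    let Ds : Submodule ℂ B := D.toNonUnitalSubalgebra.toSubmodule
    have hDs : FiniteDimensional ℂ Ds := hfd
    have hm : FiniteDimensional ℂ (Ds.map φ) := inferInstance
    let ι : D' →ₗ[ℂ] (Ds.map φ) :=
      { toFun := fun z => ⟨((z : Cnr P) : B), by
          obtain ⟨y, hy, h⟩ := z.2
          exact ⟨y, hy, h.symm⟩⟩
        map_add' := fun x y => rfl
        map_smul' := fun c x => rfl }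
    refine FiniteDimensional.of_injective ι ?_
    intro x y hxy
    have : ((x : Cnr P) : B) = ((y : Cnr P) : B) := congrArg (fun v : (Ds.map φ) => (v : B)) hxy
    exact Subtype.ext (Subtype.ext this)
  · intro y hy
    refine ⟨⟨b * (q * y * q) * P.p, ?_, ?_⟩, ⟨y, hy, rfl⟩, ?_⟩
    · rw [← mul_assoc, ← mul_assoc, hpb]
    · rw [mul_assoc _ P.p P.p, hpp]
    · simp only [mul_assoc]

open Classical in
lemma locFin_corner (hAF : ∀ (F : Finset B) (ε : ℝ), 0 < ε →
    ∃ D : NonUnitalStarSubalgebra ℂ B, FiniteDimensional ℂ D ∧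
      ∀ x ∈ F, ∃ y ∈ (D : Set B), ‖x - y‖ < ε) (P : NZProj B) : LocFin (Cnr P) := by
  intro F ε hε
  have hpp := P.idem
  have hx : ∀ x ∈ F, ∀ᶠ δ in nhdsWithin (0 : ℝ) (Set.Ioi 0), ∀ b q y : B,
      ‖b - P.p‖ ≤ 2 * δ → ‖q - P.p‖ ≤ δ → ‖(x : B) - y‖ < δ →
      ‖(x : B) - b * q * y * q * P.p‖ < ε := by
    intro x _
    have hc : Continuous fun v : B × B × B => v.1 * v.2.1 * v.2.2 * v.2.1 * P.p := by fun_prop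
    obtain ⟨κ, hκ, h⟩ := Metric.continuous_iff.1 hc (P.p, P.p, (x : B)) ε hε
    have hlt : ∀ᶠ δ in nhdsWithin (0 : ℝ) (Set.Ioi 0), δ < κ / 2 :=
      nhdsWithin_le_nhds (Iio_mem_nhds (by linarith))
    have hpos : ∀ᶠ δ in nhdsWithin (0 : ℝ) (Set.Ioi 0), 0 < δ := self_mem_nhdsWithin
    filter_upwards [hlt, hpos] with δ hδ hδ0 b q y hb hq hy
    have h1 := h (b, q, y) (by
      rw [Prod.dist_eq, Prod.dist_eq, max_lt_iff, max_lt_iff, dist_eq_norm, dist_eq_norm,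
        dist_comm, dist_eq_norm]
      exact ⟨by simpa using (by linarith : ‖b - P.p‖ < κ),
        by simpa using (by linarith : ‖q - P.p‖ < κ),
        by simpa using (by linarith : ‖(x : B) - y‖ < κ)⟩)
    simp only at h1
    rw [dist_comm, dist_eq_norm, hpp, x.2.1, x.2.2, x.2.2] at h1
    exact h1
  have hall := (Filter.eventually_all_finset F).2 hx
  have hlt : ∀ᶠ δ in nhdsWithin (0 : ℝ) (Set.Ioi 0), δ ≤ 1 / 8 :=
    nhdsWithin_le_nhds (Iic_mem_nhds (by norm_num))
  have hpos : ∀ᶠ δ in nhdsWithin (0 : ℝ) (Set.Ioi 0), 0 < δ := self_mem_nhdsWithin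
  obtain ⟨δ, hδ, hδ8, hδ0⟩ := (hall.and (hlt.and hpos)).exists
  obtain ⟨η, hη, hproj⟩ := exists_proj_near P δ hδ0
  obtain ⟨D, hfd, hD⟩ := hAF (insert P.p (F.image fun x : Cnr P => (x : B))) (min η δ)
    (lt_min hη hδ0)
  obtain ⟨q, hqD, hqs, hqq, hqp⟩ := hproj D hfd (by
    obtain ⟨d, hd, h⟩ := hD P.p (by simp)
    exact ⟨d, hd, h.trans_le (min_le_left _ _)⟩)
  have hqn : ‖q‖ ≤ 1 := by
    have h : ‖star q * q‖ = ‖q‖ * ‖q‖ := CStarRing.norm_star_mul_self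
    rw [hqs, hqq] at h
    nlinarith [norm_nonneg q]
  obtain ⟨b, hb, D', hfd', hD'⟩ := exists_sub P D hfd q hqD hqq hqn δ hδ8 hqp.le
  refine ⟨D', hfd', fun x hxF => ?_⟩
  obtain ⟨y, hy, hxy⟩ := hD (x : B)
    (Finset.mem_insert_of_mem (Finset.mem_image_of_mem (fun x : Cnr P => (x : B)) hxF))
  obtain ⟨z, hz, hzy⟩ := hD' y hy
  refine ⟨z, hz, ?_⟩
  rw [← Cnr.norm_coe, Cnr.coe_sub, hzy]
  exact hδ x hxF b q y hb hqp.le (hxy.trans_le (min_le_right _ _))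

end CornerPart

section FlowPart

variable {B : Type*} [NonUnitalCStarAlgebra B]

/-- The flow on the corner induced by a circle action fixing the projection. -/
def cornerFlow (γ : Circle → B ≃⋆ₐ[ℂ] B)
    (hmul : ∀ z w x, γ (z * w) x = γ z (γ w x))
    (hcont : ∀ x : B, Continuous fun z => γ z x)
    (P : NZProj B) (hP : ∀ z, γ z P.p = P.p) : PFlow (Cnr P) :=
  have h1 : ∀ x, γ 1 x = x := fun x => (γ 1).injective (by
    change γ 1 (γ 1 x) = γ 1 x
    rw [← hmul, one_mul])
  { γ := fun s =>
      { toFun := fun x => ⟨γ (Circle.exp s) x,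
          by rw [← hP (Circle.exp s), ← map_mul, x.2.1],
          by rw [← hP (Circle.exp s), ← map_mul, x.2.2]⟩
        map_one' := Subtype.ext (hP _)
        map_mul' := fun x y => Subtype.ext (map_mul (γ (Circle.exp s)) (x : B) y)
        map_zero' := Subtype.ext (map_zero (γ (Circle.exp s)))
        map_add' := fun x y => Subtype.ext (map_add (γ (Circle.exp s)) (x : B) y)
        commutes' := fun c => by
          apply Subtype.ext
          change γ (Circle.exp s) (c • P.p) = c • P.p
          rw [map_smul, hP] }
    norm_le := fun s x => NonUnitalStarAlgHom.norm_apply_le (γ (Circle.exp s)) (x : B)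
    cont := fun x => ((hcont x).comp Circle.exp.continuous).subtype_mk _
    add := fun s h x => Subtype.ext (by
      change γ (Circle.exp (s + h)) x = γ (Circle.exp s) (γ (Circle.exp h) x)
      rw [Circle.exp_add, hmul])
    zero := fun x => Subtype.ext (by
      change γ (Circle.exp 0) x = x
      rw [Circle.exp_zero, h1])
    per := fun x => Subtype.ext (by
      change γ (Circle.exp (2 * Real.pi)) x = x
      rw [Circle.exp_two_pi, h1]) }

/-- Compression to the corner. -/
def compress (P : NZProj B) : B →L[ℂ] Cnr P :=
  LinearMap.mkContinuous
    { toFun := fun x => ⟨P.p * x * P.p, by rw [← mul_assoc, ← mul_assoc, P.idem],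
        by rw [mul_assoc _ P.p P.p, P.idem]⟩
      map_add' := fun x y => Subtype.ext (by
        change P.p * (x + y) * P.p = P.p * x * P.p + P.p * y * P.p
        rw [mul_add, add_mul])
      map_smul' := fun c x => Subtype.ext (by
        change P.p * (c • x) * P.p = c • (P.p * x * P.p)
        rw [mul_smul_comm, smul_mul_assoc]) } 1 (by
    intro x
    change ‖P.p * x * P.p‖ ≤ 1 * ‖x‖
    refine norm_mul₃_le.trans ?_
    rw [P.norm_p]
    simp)

lemma compress_coe (P : NZProj B) (x : B) : (compress P x : B) = P.p * x * P.p := rfl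

lemma dense_smooth (γ : Circle → B ≃⋆ₐ[ℂ] B)
    (hmul : ∀ z w x, γ (z * w) x = γ z (γ w x))
    (hcont : ∀ x : B, Continuous fun z => γ z x)
    (P : NZProj B) (hP : ∀ z, γ z P.p = P.p) (S : Set B)
    (hS : closure (NonUnitalStarAlgebra.adjoin ℂ S : Set B) = Set.univ)
    (hder : ∀ x ∈ S, ∃ d, HasDerivAt (fun s : ℝ => γ (Circle.exp s) x) d 0) :
    Dense {x : Cnr P | ∃ d, HasDerivAt (fun s => (cornerFlow γ hmul hcont P hP).γ s x) d 0} := by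
  have hall : ∀ x ∈ NonUnitalStarAlgebra.adjoin ℂ S,
      ∃ d, HasDerivAt (fun s : ℝ => γ (Circle.exp s) x) d 0 := by
    intro x hx
    induction hx using NonUnitalStarAlgebra.adjoin_induction with
    | mem x hx => exact hder x hx
    | add x y _ _ hx hy =>
      obtain ⟨d, hd⟩ := hx
      obtain ⟨e, he⟩ := hy
      refine ⟨d + e, ?_⟩
      simp only [map_add]
      exact hd.add he
    | zero => exact ⟨0, by simpa using hasDerivAt_const (0 : ℝ) (0 : B)⟩
    | mul x y _ _ hx hy =>
      obtain ⟨d, hd⟩ := hx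
      obtain ⟨e, he⟩ := hy
      simp only [map_mul]
      exact ⟨_, hd_mul hd he⟩
    | smul c x _ hx =>
      obtain ⟨d, hd⟩ := hx
      refine ⟨c • d, ?_⟩
      simp only [map_smul]
      exact hd.const_smul c
    | star x _ hx =>
      obtain ⟨d, hd⟩ := hx
      refine ⟨star d, ?_⟩
      simp only [map_star]
      exact hd.star
  have hd0 : Dense (NonUnitalStarAlgebra.adjoin ℂ S : Set B) := dense_iff_closure_eq.2 hS
  have hsurj : Function.Surjective (compress P) := by
    intro x
    refine ⟨x, Subtype.ext ?_⟩
    rw [compress_coe, x.2.1, x.2.2]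
  have hd1 := hsurj.denseRange.dense_image (compress P).continuous hd0
  refine hd1.mono ?_
  rintro _ ⟨x, hx, rfl⟩
  obtain ⟨d, hd⟩ := hall x hx
  refine ⟨compress P d, ?_⟩
  have h := ((compress P).restrictScalars ℝ).hasFDerivAt.comp_hasDerivAt (0 : ℝ) hd
  refine h.congr_of_eventuallyEq (Filter.Eventually.of_forall fun s => Subtype.ext ?_)
  change γ (Circle.exp s) (P.p * x * P.p) = P.p * γ (Circle.exp s) x * P.p
  rw [map_mul, map_mul, hP]

end FlowPart

section GraphPart

variable {V E 𝒜 : Type*} {G : DirGraph V E} {L : E → 𝒜}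

lemma mem_relRng_single (A : Set V) (a : 𝒜) (v : V) :
    v ∈ relRng G L A [a] ↔ ∃ e, L e = a ∧ G.src e ∈ A ∧ G.rng e = v := by
  constructor
  · rintro ⟨⟨es, ne, ch⟩, h1, h2, h3⟩
    match es, ne, ch, h1, h2, h3 with
    | [e], _, _, h1, h2, h3 => exact ⟨e, by simpa [GPath.label] using h1, h2, h3⟩
    | e :: f :: l, _, _, h1, _, _ => simp [GPath.label] at h1
  · rintro ⟨e, h1, h2, h3⟩
    exact ⟨⟨[e], by simp, List.isChain_singleton e⟩, by simp [GPath.label, h1], h2, h3⟩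

lemma mem_relRng_cons (A : Set V) (a b : 𝒜) (w : List 𝒜) (v : V) :
    v ∈ relRng G L A (a :: b :: w) ↔
      ∃ e, L e = a ∧ G.src e ∈ A ∧ v ∈ relRng G L {G.rng e} (b :: w) := by
  constructor
  · rintro ⟨⟨es, ne, ch⟩, h1, h2, h3⟩
    match es, ne, ch, h1, h2, h3 with
    | [e], _, _, h1, _, _ => simp [GPath.label] at h1
    | e :: f :: l, _, ch, h1, h2, h3 =>
      simp only [GPath.label, List.map_cons, List.cons.injEq] at h1
      replace ch := List.isChain_cons_cons.1 ch
      refine ⟨e, h1.1, h2, ⟨f :: l, by simp, ch.2⟩, ?_, ?_, ?_⟩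
      · simp [GPath.label, h1.2.1, h1.2.2]
      · simp [GPath.source, ch.1]
      · rw [← h3]
        simp [GPath.range]
  · rintro ⟨e, h1, h2, ⟨es, ne, ch⟩, h3, h4, h5⟩
    match es, ne, ch, h3, h4, h5 with
    | f :: l, ne, ch, h3, h4, h5 =>
      refine ⟨⟨e :: f :: l, by simp, List.isChain_cons_cons.2 ⟨?_, ch⟩⟩, ?_, h2, ?_⟩
      · simpa [GPath.source] using h4.symm
      · simp only [GPath.label, List.map_cons] at h3 ⊢
        rw [h1, h3]
      · rw [← h5]
        simp [GPath.range]

lemma mem_relRng_iff (A : Set V) (w : List 𝒜) (v : V) :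
    v ∈ relRng G L A w ↔ ∃ u ∈ A, v ∈ relRng G L {u} w := by
  constructor
  · rintro ⟨p, h1, h2, h3⟩
    exact ⟨p.source, h2, p, h1, rfl, h3⟩
  · rintro ⟨u, hu, p, h1, h2, h3⟩
    rw [Set.mem_singleton_iff] at h2
    exact ⟨p, h1, h2 ▸ hu, h3⟩

lemma relRng_cons (A : Set V) (a b : 𝒜) (w : List 𝒜) :
    relRng G L A (a :: b :: w) = relRng G L (relRng G L A [a]) (b :: w) := by
  ext v
  rw [mem_relRng_cons, mem_relRng_iff]
  constructor
  · rintro ⟨e, h1, h2, h3⟩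
    exact ⟨G.rng e, (mem_relRng_single _ _ _).2 ⟨e, h1, h2, rfl⟩, h3⟩
  · rintro ⟨u, hu, h3⟩
    obtain ⟨e, h1, h2, rfl⟩ := (mem_relRng_single _ _ _).1 hu
    exact ⟨e, h1, h2, h3⟩

lemma rngW_eq (w : List 𝒜) : rngW G L w = relRng G L Set.univ w := by
  ext v
  simp [rngW, relRng]

lemma relRng_subset (A : Set V) (w : List 𝒜) : relRng G L A w ⊆ rngW G L w := by
  rintro v ⟨p, h1, _, h3⟩
  exact ⟨p, h1, h3⟩

lemma rngW_cons (a b : 𝒜) (w : List 𝒜) :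
    rngW G L (a :: b :: w) = relRng G L (rngW G L [a]) (b :: w) := by
  rw [rngW_eq, rngW_eq, relRng_cons]

lemma bbar_relRng (A : Set V) (hA : Bbar G L A) (w : List 𝒜) : Bbar G L (relRng G L A w) := by
  by_cases h : IsLabelWord G L w
  · exact Bbar.rel A w hA h
  · have : relRng G L A w = A \ A := by
      rw [Set.sdiff_self]
      refine Set.eq_empty_iff_forall_notMem.2 ?_
      rintro v ⟨p, h1, _⟩
      exact h ⟨p, h1⟩
    rw [this]
    exact Bbar.diff A A hA hA

lemma bbar_rngW (hL : Function.Surjective L) (a : 𝒜) (w : List 𝒜) : Bbar G L (rngW G L (a :: w)) := by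
  have h1 : Bbar G L (rngW G L [a]) := by
    obtain ⟨e, he⟩ := hL a
    exact Bbar.base _ ⟨⟨[e], by simp, List.isChain_singleton e⟩, by simp [GPath.label, he]⟩
  cases w with
  | nil => exact h1
  | cons b w =>
    rw [rngW_cons]
    exact bbar_relRng _ h1 _

variable {B : Type*} [NonUnitalCStarAlgebra B]

lemma p_sWord (rep : LRep G L B) (w : List 𝒜) : ∀ (a : 𝒜) (A : Set V), Bbar G L A →
    rep.p A * sWord rep.s (a :: w) = sWord rep.s (a :: w) * rep.p (relRng G L A (a :: w)) := by
  induction w with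
  | nil => exact fun a A hA => rep.p_s A a hA
  | cons b w ih =>
    intro a A hA
    simp only [sWord]
    rw [← mul_assoc, rep.p_s A a hA, mul_assoc, ih b _ (bbar_relRng A hA [a]), relRng_cons,
      mul_assoc]

lemma sWord_star_mul (hL : Function.Surjective L) (rep : LRep G L B) (w : List 𝒜) : ∀ a : 𝒜,
    star (sWord rep.s (a :: w)) * sWord rep.s (a :: w) = rep.p (rngW G L (a :: w)) := by
  induction w with
  | nil => exact rep.s_s
  | cons b w ih =>
    intro a
    simp only [sWord]
    have h1 := bbar_rngW (G := G) hL a []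
    rw [star_mul, mul_assoc, ← mul_assoc (star (rep.s a)), rep.s_s, p_sWord rep w b _ h1,
      ← mul_assoc, ih b, rep.p_mul _ _ (bbar_rngW hL b w) (bbar_relRng _ h1 _), rngW_cons,
      Set.inter_eq_right.2 (relRng_subset _ _)]

lemma gauge_sWord (rep : LRep G L B) (ga : GaugeAction G L rep) (z : Circle) (w : List 𝒜) :
    ga.γ z (sWord rep.s w) = ((z : ℂ) ^ w.length) • sWord rep.s w := by
  induction w with
  | nil => simp [sWord]
  | cons a w ih =>
    cases w with
    | nil => simpa [sWord] using ga.γ_s z a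
    | cons b w =>
      simp only [sWord]
      rw [map_mul, ih, ga.γ_s, smul_mul_smul_comm, ← pow_succ', List.length_cons (a := a)]

end GraphPart

/-- Theorem 4.2. Let `{s_a, p_A}` be a representation of
`(E, L, 𝔅̄)` in a C*-algebra `B` with `p_C ≠ 0` for every nonempty `C ∈ 𝔅̄`,
generating `B` and admitting a gauge action. If `B` is an AF algebra, then
the labeled space `(E, L, 𝔅̄)` has no loops. -/
theorem af_implies_no_loops {V E 𝒜 B : Type*}
    [Countable V] [Countable E] [Countable 𝒜]
    [NonUnitalCStarAlgebra B]
    (G : DirGraph V E) (L : E → 𝒜) (hL : Function.Surjective L)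
    (sa : StandingAssumptions G L)
    (rep : LRep G L B)
    (hp : ∀ C : Set V, Bbar G L C → C.Nonempty → rep.p C ≠ 0)
    (hgen : GeneratesAlg G L rep)
    (ga : GaugeAction G L rep)
    (hAF : IsAFAlgebra B) :
    ¬ ∃ (A : Set V) (α : List 𝒜), Bbar G L A ∧ IsLoop G L A α := by
  rintro ⟨A, α, hA, ⟨path, hpl, hps, -⟩, hAα⟩
  obtain ⟨a, w, rfl⟩ : ∃ a w, α = a :: w := by
    cases α with
    | nil =>
      exact absurd (List.map_eq_nil_iff.1 hpl) path.ne
    | cons a w => exact ⟨a, w, rfl⟩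
  let P : NZProj B :=
    { p := rep.p A
      sa := rep.p_sa A hA
      idem := by rw [rep.p_mul A A hA hA, Set.inter_self]
      ne := hp A hA ⟨_, hps⟩ }
  have hPp : P.p = rep.p A := rfl
  have hidem : rep.p A * rep.p A = rep.p A := P.idem
  have hmul : ∀ z w x, ga.γ (z * w) x = ga.γ z (ga.γ w x) := by
    intro z w x
    rw [ga.γ_mul]
    rfl
  have hP : ∀ z, ga.γ z P.p = P.p := fun z => ga.γ_p z A hA
  set t : B := sWord rep.s (a :: w) * rep.p A with ht
  have hAr : Bbar G L (relRng G L A (a :: w)) := bbar_relRng A hA _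
  have htt : star t * t = rep.p A := by
    rw [ht, star_mul, rep.p_sa A hA, mul_assoc, ← mul_assoc (star _), sWord_star_mul hL,
      rep.p_mul _ _ (bbar_rngW hL a w) hA,
      Set.inter_eq_right.2 (hAα.trans (relRng_subset _ _)), hidem]
  have hpt : rep.p A * t = t := by
    rw [ht, ← mul_assoc, p_sWord rep w a A hA, mul_assoc, rep.p_mul _ _ hAr hA,
      Set.inter_eq_right.2 hAα]
  have htp : t * rep.p A = t := by rw [ht, mul_assoc, hidem]
  have htn : ‖star t‖ ≤ 1 := by
    rw [norm_star]
    have h : ‖star t * t‖ = ‖t‖ * ‖t‖ := CStarRing.norm_star_mul_self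
    have h2 : ‖rep.p A‖ = 1 := P.norm_p
    rw [htt, h2] at h
    nlinarith [norm_nonneg t]
  let T : Cnr P := ⟨t, hpt, htp⟩
  let T' : Cnr P := ⟨star t, by
    have := congrArg star htp
    rwa [star_mul, rep.p_sa A hA] at this, by
    have := congrArg star hpt
    rwa [star_mul, rep.p_sa A hA] at this⟩
  have hdense := dense_smooth ga.γ hmul ga.γ_continuous P hP _ hgen (by
    rintro x (⟨b, rfl⟩ | ⟨C, hC, rfl⟩)
    · simp only [ga.γ_s, Circle.coe_exp]
      have h : HasDerivAt (fun s : ℝ => Complex.exp (s * Complex.I))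
          (Complex.exp ((0 : ℝ) * Complex.I) * (1 * Complex.I)) (0 : ℝ) :=
        ((Complex.ofRealCLM.hasDerivAt (x := (0 : ℝ))).mul_const Complex.I).cexp
      exact ⟨_, h.smul_const (rep.s b)⟩
    · simp only [ga.γ_p _ C hC]
      exact ⟨0, hasDerivAt_const _ _⟩)
  refine abstract_contra (locFin_corner hAF P) (cornerFlow ga.γ hmul ga.γ_continuous P hP) hdense
    T T' (Subtype.ext htt) htn (a :: w).length (by simp) ?_
  intro s
  apply Subtype.ext
  change ga.γ (Circle.exp s) (star t) = Complex.exp (-((a :: w).length * (s * Complex.I))) • star t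
  rw [map_star, ht, map_mul, gauge_sWord, ga.γ_p _ A hA, smul_mul_assoc, star_smul, Circle.coe_exp,
    ← Complex.exp_nat_mul]
  congr 1
  rw [Complex.star_def, ← Complex.exp_conj]
  congr 1
  simp

end
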